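/- Fix integers n, m ≥ 1 and a unit q in a field k with q⁴ ≠ 1. Let R be the tensor R-matrix of R_q(n) and R_q(m), indexed by pairs from S = {1,…,n} × {1,…,m}, let P be the flip matrix on S, and set R′ = R·P·R − (q² + q⁻²)·R + 2·P. Then the Majid pair condition (P·R + Id)(P·R′ − Id) = 0 holds. -/

import Mathlib

/-!
STATEMENT 10: For `n, m ≥ 1` and a unit `q` with `q⁴ ≠ 1`, let `R` be the tensor
R-matrix of `R_q(n)` and `R_q(m)`, `P` the flip matrix on `S = {1,…,n} × {1,…,m}`,
and `R′ = R·P·R − (q² + q⁻²)·R + 2·P`. Then `(P·R + Id)(P·R′ − Id) = 0`.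
-/

open Matrix

/-- The flip matrix `P` on an index set `S`: `P^{ij}_{kl} = δ_{il} δ_{jk}`. -/
def flipMatrix (k S : Type*) [Semiring k] [DecidableEq S] :
    Matrix (S × S) (S × S) k :=
  fun p q => if p.1 = q.2 ∧ p.2 = q.1 then 1 else 0

/-- The type-A R-matrix `R_q(n)`. -/
def typeAR {k : Type*} [Field k] (q : k) (n : ℕ) :
    Matrix (Fin n × Fin n) (Fin n × Fin n) k :=
  fun p r =>
    (if p.1 = p.2 then q else 1) * (if p.1 = r.1 ∧ p.2 = r.2 then 1 else 0) +
    (q - q⁻¹) * (if p.1 = r.2 ∧ p.2 = r.1 ∧ p.1 < p.2 then 1 else 0)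

/-- The tensor R-matrix of two R-matrices. -/
def tensorR {k : Type*} [CommRing k] {S₁ S₂ : Type*}
    (R₁ : Matrix (S₁ × S₁) (S₁ × S₁) k) (R₂ : Matrix (S₂ × S₂) (S₂ × S₂) k) :
    Matrix ((S₁ × S₂) × (S₁ × S₂)) ((S₁ × S₂) × (S₁ × S₂)) k :=
  fun p q => R₁ (p.1.1, p.2.1) (q.1.1, q.2.1) * R₂ (p.1.2, p.2.2) (q.1.2, q.2.2)

theorem tensorR_mul {k : Type*} [CommRing k] {S₁ S₂ : Type*} [Fintype S₁] [Fintype S₂]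
    (A C : Matrix (S₁ × S₁) (S₁ × S₁) k) (B D : Matrix (S₂ × S₂) (S₂ × S₂) k) :
    tensorR A B * tensorR C D = tensorR (A * C) (B * D) := by
  ext p r
  simp only [Matrix.mul_apply, tensorR, Finset.sum_mul_sum, Fintype.sum_prod_type]
  exact Finset.sum_congr rfl fun a _ => Finset.sum_congr rfl fun b _ =>
    Finset.sum_congr rfl fun c _ => Finset.sum_congr rfl fun d _ => by ring

theorem tensorR_one {k : Type*} [CommRing k] {S₁ S₂ : Type*} [DecidableEq S₁] [DecidableEq S₂] :
    tensorR (1 : Matrix (S₁ × S₁) (S₁ × S₁) k) (1 : Matrix (S₂ × S₂) (S₂ × S₂) k) = 1 := by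
  ext ⟨⟨a, b⟩, c, d⟩ ⟨⟨e, f⟩, g, h⟩
  simp only [tensorR, Matrix.one_apply, Prod.mk.injEq, mul_ite, mul_one, mul_zero]
  grind

theorem tensorR_flipMatrix {k : Type*} [CommRing k] {S₁ S₂ : Type*} [DecidableEq S₁]
    [DecidableEq S₂] :
    tensorR (flipMatrix k S₁) (flipMatrix k S₂) = flipMatrix k (S₁ × S₂) := by
  ext ⟨⟨a, b⟩, c, d⟩ ⟨⟨e, f⟩, g, h⟩
  simp only [tensorR, flipMatrix, Prod.mk.injEq, mul_ite, mul_one, mul_zero]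
  grind

theorem tensorR_one_add_smul_left {k : Type*} [CommRing k] {S₁ S₂ : Type*} [DecidableEq S₁]
    (c : k) (A : Matrix (S₁ × S₁) (S₁ × S₁) k) (B : Matrix (S₂ × S₂) (S₂ × S₂) k) :
    tensorR (1 + c • A) B = tensorR 1 B + c • tensorR A B := by
  ext p r
  simp only [tensorR, Matrix.add_apply, Matrix.smul_apply, smul_eq_mul]
  ring

theorem tensorR_one_add_smul_right {k : Type*} [CommRing k] {S₁ S₂ : Type*} [DecidableEq S₂]
    (c : k) (A : Matrix (S₁ × S₁) (S₁ × S₁) k) (B : Matrix (S₂ × S₂) (S₂ × S₂) k) :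
    tensorR A (1 + c • B) = tensorR A 1 + c • tensorR A B := by
  ext p r
  simp only [tensorR, Matrix.add_apply, Matrix.smul_apply, smul_eq_mul]
  ring

theorem flipMatrix_mul_apply {k S : Type*} [CommRing k] [Fintype S] [DecidableEq S]
    (M : Matrix (S × S) (S × S) k) (i j : S) (r : S × S) :
    (flipMatrix k S * M) (i, j) r = M (j, i) r := by
  rw [Matrix.mul_apply, Finset.sum_eq_single (j, i)]
  · simp [flipMatrix]
  · rintro ⟨a, b⟩ _ h
    rw [flipMatrix, if_neg, zero_mul]
    rintro ⟨rfl, rfl⟩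
    exact h rfl
  · simp

theorem flipMatrix_mul_self {k S : Type*} [CommRing k] [Fintype S] [DecidableEq S] :
    flipMatrix k S * flipMatrix k S = 1 := by
  ext ⟨i, j⟩ ⟨a, b⟩
  rw [flipMatrix_mul_apply]
  simp only [flipMatrix, Matrix.one_apply, Prod.mk.injEq]
  grind

theorem typeAR_mul_apply {k : Type*} [Field k] (q : k) (n : ℕ)
    (M : Matrix (Fin n × Fin n) (Fin n × Fin n) k) (i j : Fin n) (r : Fin n × Fin n) :
    (typeAR q n * M) (i, j) r =
      (if i = j then q else 1) * M (i, j) r + (if i < j then q - q⁻¹ else 0) * M (j, i) r := by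
  have h : ∀ s : Fin n × Fin n, typeAR q n (i, j) s =
      (if s = (i, j) then (if i = j then q else 1) else 0) +
      (if s = (j, i) then (if i < j then q - q⁻¹ else 0) else 0) := by
    rintro ⟨a, b⟩
    simp only [typeAR, Prod.mk.injEq]
    grind
  simp only [Matrix.mul_apply, h, add_mul, ite_mul, zero_mul, Finset.sum_add_distrib,
    Finset.sum_ite_eq', Finset.mem_univ, if_true]

/-- The Hecke relation for the braid form `P R` of the type-A R-matrix. -/
theorem flipMatrix_mul_typeAR_hecke {k : Type*} [Field k] {q : k} (hq : q ≠ 0) (n : ℕ) :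
    (flipMatrix k (Fin n) * typeAR q n) * (flipMatrix k (Fin n) * typeAR q n) =
      1 + (q - q⁻¹) • (flipMatrix k (Fin n) * typeAR q n) := by
  ext ⟨i, j⟩ ⟨a, b⟩
  rw [Matrix.mul_assoc, flipMatrix_mul_apply, typeAR_mul_apply]
  simp only [Matrix.add_apply, Matrix.smul_apply, smul_eq_mul, flipMatrix_mul_apply,
    Matrix.one_apply, Prod.mk.injEq, typeAR]
  have h := mul_inv_cancel₀ hq
  rcases lt_trichotomy i j with hij | rfl | hij <;> grind

theorem tensorR_typeA_majid_pair {k : Type*} [Field k] (q : k) (hq : IsUnit q)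
    (hq4 : q ^ 4 ≠ 1) (n m : ℕ) (hn : 1 ≤ n) (hm : 1 ≤ m) :
    let R := tensorR (typeAR q n) (typeAR q m)
    let P := flipMatrix k (Fin n × Fin m)
    let R' := R * P * R - (q ^ 2 + q⁻¹ ^ 2) • R + (2 : k) • P
    (P * R + 1) * (P * R' - 1) = 0 := by
  intro R P R'
  have hq0 : q ≠ 0 := hq.ne_zero
  have hP : P = tensorR (flipMatrix k (Fin n)) (flipMatrix k (Fin m)) :=
    tensorR_flipMatrix.symm
  have hPP : P * P = 1 := flipMatrix_mul_self
  set A := flipMatrix k (Fin n) * typeAR q n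
  set B := flipMatrix k (Fin m) * typeAR q m
  have hAA : A * A = 1 + (q - q⁻¹) • A := flipMatrix_mul_typeAR_hecke hq0 n
  have hBB : B * B = 1 + (q - q⁻¹) • B := flipMatrix_mul_typeAR_hecke hq0 m
  have hPR : P * R = tensorR A B := by rw [hP, tensorR_mul]
  have hPR' : P * R' = tensorR A B * tensorR A B - (q ^ 2 + q⁻¹ ^ 2) • tensorR A B
      + (2 : k) • 1 := by
    simp only [R', mul_add, mul_sub, Matrix.mul_smul, hPP, ← hPR, Matrix.mul_assoc]
  have hc : q ^ 2 + q⁻¹ ^ 2 = (q - q⁻¹) ^ 2 + 2 := by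
    field_simp
    ring
  rw [hPR', hPR, hc]
  simp only [add_mul, mul_add, mul_sub, one_mul, mul_one, Matrix.mul_smul, tensorR_mul, hAA, hBB,
    tensorR_one_add_smul_left, tensorR_one_add_smul_right, tensorR_one, smul_add]
  module
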